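/- arXiv:1911.03356 — 3 statements merged into one kernel-verified Lean document; each statement's English description precedes it below -/
import Mathlib

section
/- Let alpha, beta, gamma, S_L, S_M, S_K, B, c_L, c_M, c_so be real numbers with S_L, S_M, S_K > 0, alpha, beta, gamma > 0, B > 0, and let s_star_l > 0 and s_star_m > 0 satisfy alpha/S_L - gamma/(S_K + s_star_l) > 0 and beta/S_M - gamma/(S_K + s_star_m) > 0. If B > max( (c_L - c_so) / ((alpha/S_L - gamma/(S_K + s_star_l)) * s_star_l) , (c_M - c_so) / ((beta/S_M - gamma/(S_K + s_star_m)) * s_star_m) ), then for every real s >= s_star_l one has (alpha*B/S_L)*s - c_L > (gamma*B/(S_K + s))*s - c_so, and for every real s >= s_star_m one has (beta*B/S_M)*s - c_M > (gamma*B/(S_K + s))*s - c_so. Interpretation: when the round reward exceeds the maximum of the two bounds evaluated at the minimum leader stake s_star_l and minimum committee stake s_star_m, no leader and no committee member can increase its payoff by unilaterally defecting (Lemma 2). -/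
/-- If the reward `B` exceeds the cost gap divided by the net gain from cooperating at stake `t`,
then cooperating is strictly better than defecting at every stake `s ≥ t`. -/
theorem defect_lt_cooperate_of_threshold_lt {a g S K B c d t s : ℝ}
    (hK : 0 < K) (hg : 0 ≤ g) (hB : 0 ≤ B) (ht : 0 < t)
    (hcoef : 0 < a / S - g / (K + t))
    (hbound : (c - d) / ((a / S - g / (K + t)) * t) < B) (hs : t ≤ s) :
    g * B / (K + s) * s - d < a * B / S * s - c := by
  rw [div_lt_iff₀ (mul_pos hcoef ht)] at hbound
  have hrate : a / S - g / (K + t) ≤ a / S - g / (K + s) := by gcongr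
  have hgain : (a / S - g / (K + t)) * t ≤ (a / S - g / (K + s)) * s :=
    mul_le_mul hrate hs ht.le (hcoef.le.trans hrate)
  have hpayoff : B * ((a / S - g / (K + s)) * s) =
      a * B / S * s - g * B / (K + s) * s := by ring
  linarith [mul_le_mul_of_nonneg_left hgain hB]

/-- Lemma 2: if the round reward exceeds the maximum of the two bounds evaluated at the
minimum leader and committee stakes, no leader and no committee member can gain by defecting. -/
theorem leaders_and_committee_no_deviation
    (alpha beta gamma S_L S_M S_K B c_L c_M c_so s_star_l s_star_m : ℝ)
    (hSL : S_L > 0) (hSM : S_M > 0) (hSK : S_K > 0)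
    (halpha : alpha > 0) (hbeta : beta > 0) (hgamma : gamma > 0)
    (hB : B > 0) (hsl : s_star_l > 0) (hsm : s_star_m > 0)
    (hcoefL : alpha / S_L - gamma / (S_K + s_star_l) > 0)
    (hcoefM : beta / S_M - gamma / (S_K + s_star_m) > 0)
    (hbound : B > max
      ((c_L - c_so) / ((alpha / S_L - gamma / (S_K + s_star_l)) * s_star_l))
      ((c_M - c_so) / ((beta / S_M - gamma / (S_K + s_star_m)) * s_star_m))) :
    (∀ s : ℝ, s ≥ s_star_l →
      (alpha * B / S_L) * s - c_L > (gamma * B / (S_K + s)) * s - c_so) ∧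
    (∀ s : ℝ, s ≥ s_star_m →
      (beta * B / S_M) * s - c_M > (gamma * B / (S_K + s)) * s - c_so) := by
  obtain ⟨hL, hM⟩ := max_lt_iff.mp hbound
  exact ⟨fun _ hs => defect_lt_cooperate_of_threshold_lt hSK hgamma.le hB.le hsl hcoefL hL hs,
    fun _ hs => defect_lt_cooperate_of_threshold_lt hSK hgamma.le hB.le hsm hcoefM hM hs⟩
end

section
/- Let alpha, beta, gamma, S_L, S_M, S_K, B, c_L, c_M, c_K, c_so be real numbers with S_L, S_M, S_K > 0, alpha, beta, gamma > 0, B > 0, c_so < c_K, and let s_star_l, s_star_m, s_star_k > 0 satisfy alpha/S_L - gamma/(S_K + s_star_l) > 0 and beta/S_M - gamma/(S_K + s_star_m) > 0. If B > max( (c_L - c_so) / ((alpha/S_L - gamma/(S_K + s_star_l)) * s_star_l) , (c_M - c_so) / ((beta/S_M - gamma/(S_K + s_star_m)) * s_star_m) , (c_K - c_so) * S_K / (s_star_k * gamma) ), then: (i) for every s >= s_star_l, (alpha*B/S_L)*s - c_L > (gamma*B/(S_K + s))*s - c_so; (ii) for every s >= s_star_m, (beta*B/S_M)*s - c_M > (gamma*B/(S_K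 + s))*s - c_so; (iii) for every s >= s_star_k, (gamma*B/S_K)*s - c_K > -c_so; and (iv) for every s, (gamma*B/S_K)*s - c_so > (gamma*B/S_K)*s - c_K. Interpretation: under these conditions the strategy profile in which all leaders, all committee members, and all members of an Algorand strong synchrony set cooperate while the remaining online nodes defect is a Nash equilibrium of the Algorand game (Theorem 3). -/
/-- If the reward `B` makes cooperation strictly better than being paid as an ordinary online
node at stake `t`, it does so at every larger stake. -/
theorem cooperation_payoff_gt_defection_payoff {a g S K B c d t s : ℝ} (hK : 0 < K) (hg : 0 < g)
    (hB : 0 < B) (ht : 0 < t) (hcoef : 0 < a / S - g / (K + t))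
    (hbound : (c - d) / ((a / S - g / (K + t)) * t) < B) (hs : t ≤ s) :
    g * B / (K + s) * s - d < a * B / S * s - c := by
  have hbound_t : c - d < B * ((a / S - g / (K + t)) * t) :=
    (div_lt_iff₀ (mul_pos hcoef ht)).1 hbound
  have hrate : g / (K + s) ≤ g / (K + t) := by gcongr
  have hgain : (a / S - g / (K + t)) * t ≤ (a / S - g / (K + s)) * s :=
    mul_le_mul (by linarith) hs ht.le (by linarith)
  have hscaled := mul_le_mul_of_nonneg_left hgain hB.le
  have hsplit : B * ((a / S - g / (K + s)) * s) = a * B / S * s - g * B / (K + s) * s := by ring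
  linarith

/-- Theorem 3: if the round reward exceeds the maximum of the three bounds, the profile
where all leaders, committee members and synchrony-set nodes cooperate while the remaining
online nodes defect is a Nash equilibrium. -/
theorem role_based_nash_equilibrium
    (alpha beta gamma S_L S_M S_K B c_L c_M c_K c_so s_star_l s_star_m s_star_k : ℝ)
    (hSL : S_L > 0) (hSM : S_M > 0) (hSK : S_K > 0)
    (halpha : alpha > 0) (hbeta : beta > 0) (hgamma : gamma > 0)
    (hB : B > 0) (hcK : c_so < c_K)
    (hsl : s_star_l > 0) (hsm : s_star_m > 0) (hsk : s_star_k > 0)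
    (hcoefL : alpha / S_L - gamma / (S_K + s_star_l) > 0)
    (hcoefM : beta / S_M - gamma / (S_K + s_star_m) > 0)
    (hbound : B > max (max
      ((c_L - c_so) / ((alpha / S_L - gamma / (S_K + s_star_l)) * s_star_l))
      ((c_M - c_so) / ((beta / S_M - gamma / (S_K + s_star_m)) * s_star_m)))
      ((c_K - c_so) * S_K / (s_star_k * gamma))) :
    (∀ s : ℝ, s ≥ s_star_l →
      (alpha * B / S_L) * s - c_L > (gamma * B / (S_K + s)) * s - c_so) ∧
    (∀ s : ℝ, s ≥ s_star_m →
      (beta * B / S_M) * s - c_M > (gamma * B / (S_K + s)) * s - c_so) ∧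
    (∀ s : ℝ, s ≥ s_star_k → (gamma * B / S_K) * s - c_K > -c_so) ∧
    (∀ s : ℝ, (gamma * B / S_K) * s - c_so > (gamma * B / S_K) * s - c_K) := by
  obtain ⟨hLM, hK⟩ := max_lt_iff.1 hbound
  obtain ⟨hL, hM⟩ := max_lt_iff.1 hLM
  refine ⟨fun s hs => cooperation_payoff_gt_defection_payoff hSK hgamma hB hsl hcoefL hL hs,
    fun s hs => cooperation_payoff_gt_defection_payoff hSK hgamma hB hsm hcoefM hM hs,
    fun s hs => ?_, fun s => by linarith⟩
  have hcost : c_K - c_so < gamma * B / S_K * s_star_k := by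
    rw [div_lt_iff₀ (mul_pos hsk hgamma)] at hK
    rw [div_mul_eq_mul_div, lt_div_iff₀ hSK]
    linarith
  have hmono : gamma * B / S_K * s_star_k ≤ gamma * B / S_K * s :=
    mul_le_mul_of_nonneg_left hs (by positivity)
  linarith
end

section
/- Let alpha, beta, gamma, S_L, S_M, S_K, c_L, c_M, c_K, c_so be real numbers with S_L, S_M, S_K > 0, alpha, beta, gamma > 0, c_so < c_K, and let s_star_l, s_star_m, s_star_k > 0 satisfy alpha/S_L - gamma/(S_K + s_star_l) > 0 and beta/S_M - gamma/(S_K + s_star_m) > 0. Then there exists a real B > 0 such that simultaneously: for every s >= s_star_l, (alpha*B/S_L)*s - c_L > (gamma*B/(S_K + s))*s - c_so; for every s >= s_star_m, (beta*B/S_M)*s - c_M > (gamma*B/(S_K + s))*s - c_so; and for every s >= s_star_k, (gamma*B/S_K)*s - c_K > -c_so. Interpretation: an incentive-compatible per-round reward always exists under the role-based reward scheme, i.e., the designer can always choose a reward large enough that all leaders, committee members, and synchrony-set online nodes strictly prefer cooperation (corollary of Theorem 3, underlying Algorithm 1). -/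
open Filter in
/-- A node whose cooperative per-stake rate exceeds its defection rate at the minimum stake `s₀`
strictly prefers cooperation at every stake `s ≥ s₀`, once the reward `B` is large enough. -/
theorem eventually_cooperation_gt_defection {a g S K s₀ : ℝ} (c d : ℝ) (hK : 0 < K) (hg : 0 < g)
    (hs₀ : 0 < s₀) (hcoef : 0 < a / S - g / (K + s₀)) :
    ∀ᶠ B : ℝ in atTop, ∀ s ≥ s₀, (a * B / S) * s - c > (g * B / (K + s)) * s - d := by
  have hlarge : ∀ᶠ B : ℝ in atTop, c - d < B * ((a / S - g / (K + s₀)) * s₀) :=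
    (tendsto_id.atTop_mul_const (mul_pos hcoef hs₀)).eventually_gt_atTop _
  filter_upwards [hlarge, eventually_gt_atTop 0] with B hB hB0 s hs
  have hrate : a / S - g / (K + s₀) ≤ a / S - g / (K + s) := by gcongr
  have hgain : B * ((a / S - g / (K + s₀)) * s₀) ≤ B * ((a / S - g / (K + s)) * s) := by
    have := hcoef.le.trans hrate
    gcongr
  have hsplit : B * ((a / S - g / (K + s)) * s) = (a * B / S) * s - (g * B / (K + s)) * s := by
    ring
  linarith

open Filter in
/-- For a large enough reward `B`, a positive per-stake rate `g / S` covers any fixed cost at every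
stake `s ≥ s₀`. -/
theorem eventually_reward_gt_cost {g S s₀ : ℝ} (c d : ℝ) (hg : 0 < g) (hS : 0 < S) (hs₀ : 0 < s₀) :
    ∀ᶠ B : ℝ in atTop, ∀ s ≥ s₀, (g * B / S) * s - c > -d := by
  have hlarge : ∀ᶠ B : ℝ in atTop, c - d < B * (g / S * s₀) :=
    (tendsto_id.atTop_mul_const (by positivity)).eventually_gt_atTop _
  filter_upwards [hlarge, eventually_gt_atTop 0] with B hB hB0 s hs
  have hgain : B * (g / S * s₀) ≤ B * (g / S * s) := by gcongr
  have hassoc : B * (g / S * s) = (g * B / S) * s := by ring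
  linarith

/-- Corollary of Theorem 3: an incentive-compatible per-round reward always exists. -/
theorem exists_incentive_compatible_reward
    (alpha beta gamma S_L S_M S_K c_L c_M c_K c_so s_star_l s_star_m s_star_k : ℝ)
    (hSL : S_L > 0) (hSM : S_M > 0) (hSK : S_K > 0)
    (halpha : alpha > 0) (hbeta : beta > 0) (hgamma : gamma > 0)
    (hcK : c_so < c_K)
    (hsl : s_star_l > 0) (hsm : s_star_m > 0) (hsk : s_star_k > 0)
    (hcoefL : alpha / S_L - gamma / (S_K + s_star_l) > 0)
    (hcoefM : beta / S_M - gamma / (S_K + s_star_m) > 0) :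
    ∃ B : ℝ, B > 0 ∧
      (∀ s : ℝ, s ≥ s_star_l →
        (alpha * B / S_L) * s - c_L > (gamma * B / (S_K + s)) * s - c_so) ∧
      (∀ s : ℝ, s ≥ s_star_m →
        (beta * B / S_M) * s - c_M > (gamma * B / (S_K + s)) * s - c_so) ∧
      (∀ s : ℝ, s ≥ s_star_k → (gamma * B / S_K) * s - c_K > -c_so) := by
  exact ((Filter.eventually_gt_atTop 0).and <|
    (eventually_cooperation_gt_defection c_L c_so hSK hgamma hsl hcoefL).and <|
    (eventually_cooperation_gt_defection c_M c_so hSK hgamma hsm hcoefM).and <|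
    eventually_reward_gt_cost c_K c_so hgamma hSK hsk).exists
end
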